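/- (Lower bound of the Lyapunov function.) Under the stated assumptions, if β > β′, where β′ = max{2(L_f + L_{g,2}), (2α₂/κ̲₁)(7L_f²+4L_g²), (α₂/κ̲₂)(7L_f²+4L_g²) + ((4α₂+2)κ̄₂²)/κ̲₂, ((3α₂+2)/κ̲₃)L_f², ((3α₂+2)/κ̲₄)L_f² + ((3α₂+1)κ̄₄²)/κ̲₄}, then for all k the Lyapunov value satisfies Ψ^{k+1} ≥ f* + g*. -/

import Mathlib

open scoped RealInnerProductSpace
open Matrix

noncomputable section

/-- `ℝ^{4n}`, regarded as `n` blocks of `ℝ⁴`. -/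
abbrev E4 (n : ℕ) := EuclideanSpace ℝ (Fin n × Fin 4)

/-- `ℝ^{3n}`, regarded as `n` blocks of `ℝ³`. -/
abbrev E3 (n : ℕ) := EuclideanSpace ℝ (Fin n × Fin 3)

/-- The product of `n` unit spheres in `ℝ⁴`: each 4-coordinate block has norm 1. -/
def Msph (n : ℕ) : Set (E4 n) := {x | ∀ i : Fin n, ∑ j : Fin 4, x (i, j) ^ 2 = 1}

/-- Partial gradient of `f` w.r.t. its first block. -/
def grad1f {n : ℕ} (f : E4 n → E4 n → E3 n → E3 n → ℝ) (a b : E4 n) (c d : E3 n) : E4 n :=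
  gradient (fun y => f y b c d) a

/-- Partial gradient of `f` w.r.t. its second block. -/
def grad2f {n : ℕ} (f : E4 n → E4 n → E3 n → E3 n → ℝ) (a b : E4 n) (c d : E3 n) : E4 n :=
  gradient (fun y => f a y c d) b

/-- Partial gradient of `f` w.r.t. its third block. -/
def grad3f {n : ℕ} (f : E4 n → E4 n → E3 n → E3 n → ℝ) (a b : E4 n) (c d : E3 n) : E3 n :=
  gradient (fun y => f a b y d) c

/-- Partial gradient of `f` w.r.t. its fourth block. -/
def grad4f {n : ℕ} (f : E4 n → E4 n → E3 n → E3 n → ℝ) (a b : E4 n) (c d : E3 n) : E3 n :=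
  gradient (fun y => f a b c y) d

/-- Partial gradient of `g` w.r.t. its first block. -/
def grad1g {n : ℕ} (g : E4 n → E4 n → ℝ) (a b : E4 n) : E4 n :=
  gradient (fun y => g y b) a

/-- Partial gradient of `g` w.r.t. its second block. -/
def grad2g {n : ℕ} (g : E4 n → E4 n → ℝ) (a b : E4 n) : E4 n :=
  gradient (fun y => g a y) b

/-- The quadratic form `‖v‖²_H = ⟨v, Hv⟩` of a matrix `H`. -/
def qf {ι : Type*} [Fintype ι] [DecidableEq ι] (H : Matrix ι ι ℝ)
    (v : EuclideanSpace ℝ ι) : ℝ :=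
  ⟪v, Matrix.toEuclideanLin H v⟫

/-- The augmented Lagrangian
`L_β(x,λ) = f + g − ⟨λ₁, x₁−x₂⟩ − ⟨λ₂, x₃−x₄⟩ + (β/2)(‖x₁−x₂‖² + ‖x₃−x₄‖²)`. -/
def augL {n : ℕ} (f : E4 n → E4 n → E3 n → E3 n → ℝ) (g : E4 n → E4 n → ℝ) (β : ℝ)
    (x1 x2 : E4 n) (x3 x4 : E3 n) (l1 : E4 n) (l2 : E3 n) : ℝ :=
  f x1 x2 x3 x4 + g x1 x2 - ⟪l1, x1 - x2⟫ - ⟪l2, x3 - x4⟫ +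
    β / 2 * (‖x1 - x2‖ ^ 2 + ‖x3 - x4‖ ^ 2)


/-- The integrated one-sided Lipschitz bound on `[0, 1]`. -/
theorem le_add_half_of_deriv_sub_le {φ φ' : ℝ → ℝ} {C : ℝ}
    (hφ : ∀ t, HasDerivAt φ (φ' t) t) (hC : ∀ t, 0 ≤ t → φ' t - φ' 0 ≤ C * t) :
    φ 1 ≤ φ 0 + φ' 0 + C / 2 := by
  have hψ : ∀ t, HasDerivAt (fun t => φ t - φ' 0 * t - C / 2 * t ^ 2)
      (φ' t - φ' 0 - C * t) t := by
    intro t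
    have h1 : HasDerivAt (fun t : ℝ => φ' 0 * t) (φ' 0) t := by
      simpa using (hasDerivAt_id t).const_mul (φ' 0)
    have h2 : HasDerivAt (fun t : ℝ => C / 2 * t ^ 2) (C * t) t := by
      refine ((hasDerivAt_pow 2 t).const_mul (C / 2)).congr_deriv ?_
      norm_num
      ring
    exact ((hφ t).sub h1).sub h2
  have hanti : AntitoneOn (fun t => φ t - φ' 0 * t - C / 2 * t ^ 2) (Set.Ici (0 : ℝ)) := by
    apply antitoneOn_of_deriv_nonpos (convex_Ici 0)
    · exact fun t _ => (hψ t).continuousAt.continuousWithinAt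
    · exact fun t _ => (hψ t).differentiableAt.differentiableWithinAt
    · intro t ht
      rw [interior_Ici] at ht
      rw [(hψ t).deriv]
      linarith [hC t (le_of_lt ht)]
  have := hanti (Set.mem_Ici.2 le_rfl) (Set.mem_Ici.2 zero_le_one) zero_le_one
  simp only at this
  linarith

/-- First-order condition along a line for a function plus a quadratic polynomial. -/
theorem add_eq_zero_of_forall_le {φ : ℝ → ℝ} {D A B : ℝ} (hφ : HasDerivAt φ D 0)
    (hmin : ∀ t, φ 0 ≤ φ t + A * t + B * t ^ 2) : D + A = 0 := by
  have h1 : HasDerivAt (fun t : ℝ => A * t) A 0 := by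
    simpa using (hasDerivAt_id (0 : ℝ)).const_mul A
  have h2 : HasDerivAt (fun t : ℝ => B * t ^ 2) 0 0 := by
    simpa using (hasDerivAt_pow 2 (0 : ℝ)).const_mul B
  have h := (hφ.add h1).add h2
  have hloc : IsLocalMin (((φ + fun t : ℝ => A * t)) + fun t : ℝ => B * t ^ 2) 0 :=
    Filter.Eventually.of_forall fun t => by simpa using hmin t
  simpa using hloc.hasDerivAt_eq_zero h

theorem HasGradientAt.add_fun {E : Type*} [NormedAddCommGroup E]
    [InnerProductSpace ℝ E] [CompleteSpace E] {F₁ F₂ : E → ℝ} {G₁ G₂ y : E}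
    (h₁ : HasGradientAt F₁ G₁ y) (h₂ : HasGradientAt F₂ G₂ y) :
    HasGradientAt (fun z => F₁ z + F₂ z) (G₁ + G₂) y := by
  rw [hasGradientAt_iff_hasFDerivAt, map_add]
  exact h₁.hasFDerivAt.add h₂.hasFDerivAt

theorem HasGradientAt.hasDerivAt_line {E : Type*} [NormedAddCommGroup E]
    [InnerProductSpace ℝ E] [CompleteSpace E] {F : E → ℝ} {G y v : E} {t : ℝ}
    (hF : HasGradientAt F G (y + t • v)) :
    HasDerivAt (fun s : ℝ => F (y + s • v)) ⟪G, v⟫ t := by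
  have hl : HasDerivAt (fun s : ℝ => y + s • v) v t := by
    simpa using ((hasDerivAt_id t).smul_const v).const_add y
  exact (HasFDerivAt.comp_hasDerivAt (f := fun s : ℝ => y + s • v) t hF.hasFDerivAt
    hl).congr_deriv (InnerProductSpace.toDual_apply_apply ..)

/-- Young's inequality for inner products. -/
theorem neg_inner_le_young {E : Type*} [NormedAddCommGroup E] [InnerProductSpace ℝ E]
    {c : ℝ} (hc : 0 < c) (a b : E) :
    -⟪a, b⟫ ≤ 1 / c * ‖a‖ ^ 2 + c / 4 * ‖b‖ ^ 2 := by
  have h := abs_real_inner_le_norm a b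
  have h2 := neg_abs_le ⟪a, b⟫
  have h3 : 1 / c * ‖a‖ ^ 2 + c / 4 * ‖b‖ ^ 2 - ‖a‖ * ‖b‖
      = 1 / c * (‖a‖ - c / 2 * ‖b‖) ^ 2 := by
    field_simp
    ring
  have h4 : 0 ≤ 1 / c * (‖a‖ - c / 2 * ‖b‖) ^ 2 := by positivity
  linarith

theorem pos_of_isLeast {ι : Type*} [Fintype ι] {H : Matrix ι ι ℝ} (hH : H.PosDef)
    {κ : ℝ} (hκ : IsLeast {μ : ℝ | ∃ v : ι → ℝ, v ≠ 0 ∧ H *ᵥ v = μ • v} κ) : 0 < κ := by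
  obtain ⟨v, hv, hv'⟩ := hκ.1
  have h := hH.dotProduct_mulVec_pos hv
  rw [hv', dotProduct_smul, smul_eq_mul] at h
  have h2 : 0 ≤ star v ⬝ᵥ v := dotProduct_star_self_nonneg v
  exact pos_of_mul_pos_left h h2

section QuadraticForm

variable {ι : Type*} [Fintype ι] [DecidableEq ι] {H : Matrix ι ι ℝ}

theorem inner_toEuclideanLin_comm (hH : H.IsHermitian) (v w : EuclideanSpace ℝ ι) :
    ⟪v, Matrix.toEuclideanLin H w⟫ = ⟪Matrix.toEuclideanLin H v, w⟫ :=
  ((Matrix.isSymmetric_toEuclideanLin_iff.2 hH) v w).symm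

theorem toEuclideanLin_eigenvectorBasis (hH : H.IsHermitian) (i : ι) :
    Matrix.toEuclideanLin H (hH.eigenvectorBasis i)
      = hH.eigenvalues i • hH.eigenvectorBasis i := by
  ext j
  simpa [Matrix.toLpLin_apply] using congrFun (hH.mulVec_eigenvectorBasis i) j

theorem inner_eigenvectorBasis_toEuclideanLin (hH : H.IsHermitian) (i : ι)
    (v : EuclideanSpace ℝ ι) :
    ⟪hH.eigenvectorBasis i, Matrix.toEuclideanLin H v⟫
      = hH.eigenvalues i * ⟪hH.eigenvectorBasis i, v⟫ := by
  rw [inner_toEuclideanLin_comm hH, toEuclideanLin_eigenvectorBasis, real_inner_smul_left]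

theorem eigenvalues_mem_eigenvalueSet (hH : H.IsHermitian) (i : ι) :
    hH.eigenvalues i ∈ {μ : ℝ | ∃ v : ι → ℝ, v ≠ 0 ∧ H *ᵥ v = μ • v} := by
  refine ⟨hH.eigenvectorBasis i, fun h => ?_, hH.mulVec_eigenvectorBasis i⟩
  refine hH.eigenvectorBasis.orthonormal.ne_zero i ?_
  ext j
  simpa using congrFun h j

theorem le_qf_of_isLeast (hH : H.IsHermitian) {κ : ℝ}
    (hκ : IsLeast {μ : ℝ | ∃ v : ι → ℝ, v ≠ 0 ∧ H *ᵥ v = μ • v} κ)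
    (v : EuclideanSpace ℝ ι) : κ * ‖v‖ ^ 2 ≤ qf H v := by
  have h1 : qf H v = ∑ i, hH.eigenvalues i * ⟪hH.eigenvectorBasis i, v⟫ ^ 2 := by
    rw [qf, ← hH.eigenvectorBasis.sum_inner_mul_inner]
    refine Finset.sum_congr rfl fun i _ => ?_
    rw [inner_eigenvectorBasis_toEuclideanLin, real_inner_comm]
    ring
  rw [h1, ← hH.eigenvectorBasis.sum_sq_inner_right v, Finset.mul_sum]
  exact Finset.sum_le_sum fun i _ => mul_le_mul_of_nonneg_right
    (hκ.2 (eigenvalues_mem_eigenvalueSet hH i)) (sq_nonneg _)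

theorem norm_toEuclideanLin_sq_le_of_isGreatest (hH : H.PosDef) {κ : ℝ}
    (hκ : IsGreatest {μ : ℝ | ∃ v : ι → ℝ, v ≠ 0 ∧ H *ᵥ v = μ • v} κ)
    (v : EuclideanSpace ℝ ι) :
    ‖Matrix.toEuclideanLin H v‖ ^ 2 ≤ κ ^ 2 * ‖v‖ ^ 2 := by
  rw [← hH.1.eigenvectorBasis.sum_sq_inner_right v,
    ← hH.1.eigenvectorBasis.sum_sq_inner_right (Matrix.toEuclideanLin H v), Finset.mul_sum]
  refine Finset.sum_le_sum fun i _ => ?_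
  rw [inner_eigenvectorBasis_toEuclideanLin, mul_pow]
  exact mul_le_mul_of_nonneg_right (pow_le_pow_left₀ (hH.eigenvalues_pos i).le
    (hκ.2 (eigenvalues_mem_eigenvalueSet hH.1 i)) 2) (sq_nonneg _)

theorem qf_sub (A B : Matrix ι ι ℝ) (v : EuclideanSpace ℝ ι) :
    qf (A - B) v = qf A v - qf B v := by
  simp [qf, inner_sub_right]

theorem qf_add (A B : Matrix ι ι ℝ) (v : EuclideanSpace ℝ ι) :
    qf (A + B) v = qf A v + qf B v := by
  simp [qf, inner_add_right]

theorem qf_smul (c : ℝ) (A : Matrix ι ι ℝ) (v : EuclideanSpace ℝ ι) :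
    qf (c • A) v = c * qf A v := by
  simp [qf, inner_smul_right]

theorem qf_one (v : EuclideanSpace ℝ ι) : qf (1 : Matrix ι ι ℝ) v = ‖v‖ ^ 2 := by
  simp [qf]

theorem qf_transpose_mul_self (hH : H.IsHermitian) (v : EuclideanSpace ℝ ι) :
    qf (Hᵀ * H) v = ‖Matrix.toEuclideanLin H v‖ ^ 2 := by
  have h : Hᵀ = H := by simpa using hH.eq
  rw [h, qf, ← real_inner_self_eq_norm_sq, ← inner_toEuclideanLin_comm hH]
  congr 1
  ext j
  simp [Matrix.toLpLin_apply]

theorem qf_shifted_lower_bound (hH : H.PosDef) {κlo κhi α β c e p q : ℝ} (hβ : 0 < β)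
    (hlo : IsLeast {μ : ℝ | ∃ v : ι → ℝ, v ≠ 0 ∧ H *ᵥ v = μ • v} κlo)
    (hhi : IsGreatest {μ : ℝ | ∃ v : ι → ℝ, v ≠ 0 ∧ H *ᵥ v = μ • v} κhi)
    (hpq : 0 ≤ α * p + q) (h : α * c + e + (α * p + q) * κhi ^ 2 ≤ β * κlo)
    (v : EuclideanSpace ℝ ι) :
    1 / β * (e * ‖v‖ ^ 2 + q * ‖Matrix.toEuclideanLin H v‖ ^ 2) ≤
      qf (H - (α / β) • (c • 1 + p • (Hᵀ * H))) v := by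
  have h1 := mul_le_mul_of_nonneg_left (le_qf_of_isLeast hH.1 hlo v) hβ.le
  have h2 := mul_le_mul_of_nonneg_left (norm_toEuclideanLin_sq_le_of_isGreatest hH hhi v) hpq
  have h3 := mul_le_mul_of_nonneg_right h (sq_nonneg ‖v‖)
  rw [qf_sub, qf_smul, qf_add, qf_smul, qf_smul, qf_one, qf_transpose_mul_self hH.1]
  refine le_of_mul_le_mul_left ?_ hβ
  rw [mul_sub, ← mul_assoc, ← mul_assoc, mul_one_div_cancel hβ.ne', mul_div_cancel₀ _ hβ.ne']
  linarith

/-- Optimality of a proximal step on an augmented Lagrangian, tested against the residual. -/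
theorem inner_residual_of_prox_min (hH : H.IsHermitian) {F : EuclideanSpace ℝ ι → ℝ}
    {G y a b l : EuclideanSpace ℝ ι} {β : ℝ} (hF : HasGradientAt F G y)
    (hmin : ∀ z, F y - ⟪l, a - y⟫ + β / 2 * ‖a - y‖ ^ 2 + 1 / 2 * qf H (y - b) ≤
      F z - ⟪l, a - z⟫ + β / 2 * ‖a - z‖ ^ 2 + 1 / 2 * qf H (z - b)) :
    ⟪G, a - y⟫ + ⟪l, a - y⟫ - β * ‖a - y‖ ^ 2
      + ⟪Matrix.toEuclideanLin H (y - b), a - y⟫ = 0 := by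
  set r := a - y with hr
  have hd : HasDerivAt (fun s : ℝ => F (y + s • r)) ⟪G, r⟫ 0 :=
    HasGradientAt.hasDerivAt_line (by simpa using hF)
  have h := add_eq_zero_of_forall_le
    (A := ⟪l, r⟫ - β * ‖r‖ ^ 2 + ⟪Matrix.toEuclideanLin H (y - b), r⟫)
    (B := β / 2 * ‖r‖ ^ 2 + 1 / 2 * qf H r) hd ?_
  · linarith
  intro t
  have hm := hmin (y + t • r)
  have e1 : a - (y + t • r) = (1 - t) • r := by rw [hr]; module
  have e2 : y + t • r - b = (y - b) + t • r := by abel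
  have e3 : qf H ((y - b) + t • r) = qf H (y - b)
      + 2 * t * ⟪Matrix.toEuclideanLin H (y - b), r⟫ + t ^ 2 * qf H r := by
    have hc := inner_toEuclideanLin_comm hH (y - b) r
    have hc' := real_inner_comm r (Matrix.toEuclideanLin H (y - b))
    simp only [qf, map_add, map_smul, inner_add_left, inner_add_right, real_inner_smul_left,
      real_inner_smul_right]
    rw [hc, hc']
    ring
  rw [e1, e2, e3, norm_smul, real_inner_smul_right, mul_pow, Real.norm_eq_abs, sq_abs] at hm
  simp only [zero_smul, add_zero]
  linarith

end QuadraticForm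

section Smoothness

variable {n : ℕ}

theorem hasGradientAt_second {f : E4 n → E4 n → E3 n → E3 n → ℝ}
    (hf : ContDiff ℝ 1 fun p : (E4 n × E4 n) × E3 n × E3 n => f p.1.1 p.1.2 p.2.1 p.2.2)
    (a b : E4 n) (c d : E3 n) :
    HasGradientAt (fun y => f a y c d) (grad2f f a b c d) b := by
  have h : Differentiable ℝ fun y : E4 n => f a y c d :=
    (hf.differentiable one_ne_zero).comp
      (g := fun p : (E4 n × E4 n) × E3 n × E3 n => f p.1.1 p.1.2 p.2.1 p.2.2)
      (f := fun y : E4 n => ((a, y), c, d)) (by fun_prop)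
  exact (h b).hasGradientAt

theorem hasGradientAt_fourth {f : E4 n → E4 n → E3 n → E3 n → ℝ}
    (hf : ContDiff ℝ 1 fun p : (E4 n × E4 n) × E3 n × E3 n => f p.1.1 p.1.2 p.2.1 p.2.2)
    (a b : E4 n) (c d : E3 n) :
    HasGradientAt (fun y => f a b c y) (grad4f f a b c d) d := by
  have h : Differentiable ℝ fun y : E3 n => f a b c y :=
    (hf.differentiable one_ne_zero).comp
      (g := fun p : (E4 n × E4 n) × E3 n × E3 n => f p.1.1 p.1.2 p.2.1 p.2.2)
      (f := fun y : E3 n => ((a, b), c, y)) (by fun_prop)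
  exact (h d).hasGradientAt

theorem hasGradientAt_g_second {g : E4 n → E4 n → ℝ}
    (hg : ContDiff ℝ 1 fun p : E4 n × E4 n => g p.1 p.2) (a b : E4 n) :
    HasGradientAt (fun y => g a y) (grad2g g a b) b := by
  have h : Differentiable ℝ fun y : E4 n => g a y :=
    (hg.differentiable one_ne_zero).comp
      (g := fun p : E4 n × E4 n => g p.1 p.2) (f := fun y : E4 n => (a, y)) (by fun_prop)
  exact (h b).hasGradientAt

theorem hasDerivAt_second_fourth {f : E4 n → E4 n → E3 n → E3 n → ℝ}
    (hf : ContDiff ℝ 1 fun p : (E4 n × E4 n) × E3 n × E3 n => f p.1.1 p.1.2 p.2.1 p.2.2)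
    (a b u : E4 n) (c d w : E3 n) (t : ℝ) :
    HasDerivAt (fun s : ℝ => f a (b + s • u) c (d + s • w))
      (⟪grad2f f a (b + t • u) c (d + t • w), u⟫ + ⟪grad4f f a (b + t • u) c (d + t • w), w⟫)
      t := by
  set P : (E4 n × E4 n) × E3 n × E3 n → ℝ := fun p => f p.1.1 p.1.2 p.2.1 p.2.2 with hP
  set q : (E4 n × E4 n) × E3 n × E3 n := ((a, b + t • u), c, d + t • w) with hq
  have hPq : HasFDerivAt P (fderiv ℝ P q) q := (hf.differentiable one_ne_zero q).hasFDerivAt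
  have hb : HasDerivAt (fun s : ℝ => b + s • u) u t := by
    simpa using ((hasDerivAt_id t).smul_const u).const_add b
  have hd : HasDerivAt (fun s : ℝ => d + s • w) w t := by
    simpa using ((hasDerivAt_id t).smul_const w).const_add d
  have hu : HasDerivAt (fun s : ℝ => f a (b + s • u) c (d + t • w))
      (fderiv ℝ P q ((0, u), 0, 0)) t :=
    HasFDerivAt.comp_hasDerivAt (l := P) (f := fun s : ℝ => ((a, b + s • u), c, d + t • w)) t hPq
      (((hasDerivAt_const t a).prodMk hb).prodMk ((hasDerivAt_const t c).prodMk
        (hasDerivAt_const t (d + t • w))))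
  have hw : HasDerivAt (fun s : ℝ => f a (b + t • u) c (d + s • w))
      (fderiv ℝ P q ((0, 0), 0, w)) t :=
    HasFDerivAt.comp_hasDerivAt (l := P) (f := fun s : ℝ => ((a, b + t • u), c, d + s • w)) t hPq
      (((hasDerivAt_const t a).prodMk (hasDerivAt_const t (b + t • u))).prodMk
        ((hasDerivAt_const t c).prodMk hd))
  have huw : HasDerivAt (fun s : ℝ => f a (b + s • u) c (d + s • w))
      (fderiv ℝ P q ((0, u), 0, w)) t :=
    HasFDerivAt.comp_hasDerivAt (l := P) (f := fun s : ℝ => ((a, b + s • u), c, d + s • w)) t hPq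
      (((hasDerivAt_const t a).prodMk hb).prodMk ((hasDerivAt_const t c).prodMk hd))
  have eu := hu.unique (hasGradientAt_second hf a (b + t • u) c (d + t • w)).hasDerivAt_line
  have ew := hw.unique (hasGradientAt_fourth hf a (b + t • u) c (d + t • w)).hasDerivAt_line
  rw [← eu, ← ew, ← map_add]
  simpa using huw

theorem inner_add_inner_le_sqrt_mul_sqrt {E F : Type*} [NormedAddCommGroup E]
    [InnerProductSpace ℝ E] [NormedAddCommGroup F] [InnerProductSpace ℝ F] (p u : E) (q w : F) :
    ⟪p, u⟫ + ⟪q, w⟫ ≤ √(‖p‖ ^ 2 + ‖q‖ ^ 2) * √(‖u‖ ^ 2 + ‖w‖ ^ 2) := by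
  have h1 := real_inner_le_norm p u
  have h2 := real_inner_le_norm q w
  rw [← Real.sqrt_mul (by positivity)]
  refine Real.le_sqrt_of_sq_le ?_ |>.trans' (add_le_add h1 h2)
  nlinarith [sq_nonneg (‖p‖ * ‖w‖ - ‖q‖ * ‖u‖)]

theorem lipschitz_second_fourth {f : E4 n → E4 n → E3 n → E3 n → ℝ} {L : ℝ}
    (hL : ∀ a b : E4 n, ∀ c d : E3 n, ∀ a' b' : E4 n, ∀ c' d' : E3 n,
      √(‖grad1f f a b c d - grad1f f a' b' c' d'‖ ^ 2 +
          ‖grad2f f a b c d - grad2f f a' b' c' d'‖ ^ 2 +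
          ‖grad3f f a b c d - grad3f f a' b' c' d'‖ ^ 2 +
          ‖grad4f f a b c d - grad4f f a' b' c' d'‖ ^ 2) ≤
        L * √(‖a - a'‖ ^ 2 + ‖b - b'‖ ^ 2 + ‖c - c'‖ ^ 2 + ‖d - d'‖ ^ 2))
    (a b : E4 n) (c d : E3 n) (b' : E4 n) (d' : E3 n) :
    √(‖grad2f f a b c d - grad2f f a b' c d'‖ ^ 2
      + ‖grad4f f a b c d - grad4f f a b' c d'‖ ^ 2) ≤ L * √(‖b - b'‖ ^ 2 + ‖d - d'‖ ^ 2) := by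
  refine (Real.sqrt_le_sqrt ?_).trans ((hL a b c d a b' c d').trans_eq (by simp))
  linarith [sq_nonneg ‖grad1f f a b c d - grad1f f a b' c d'‖,
    sq_nonneg ‖grad3f f a b c d - grad3f f a b' c d'‖]

theorem lipschitz_second {f : E4 n → E4 n → E3 n → E3 n → ℝ} {L : ℝ}
    (hL : ∀ a b : E4 n, ∀ c d : E3 n, ∀ a' b' : E4 n, ∀ c' d' : E3 n,
      √(‖grad1f f a b c d - grad1f f a' b' c' d'‖ ^ 2 +
          ‖grad2f f a b c d - grad2f f a' b' c' d'‖ ^ 2 +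
          ‖grad3f f a b c d - grad3f f a' b' c' d'‖ ^ 2 +
          ‖grad4f f a b c d - grad4f f a' b' c' d'‖ ^ 2) ≤
        L * √(‖a - a'‖ ^ 2 + ‖b - b'‖ ^ 2 + ‖c - c'‖ ^ 2 + ‖d - d'‖ ^ 2))
    (a b : E4 n) (c d c' d' : E3 n) :
    ‖grad2f f a b c d - grad2f f a b c' d'‖ ≤ L * √(‖c - c'‖ ^ 2 + ‖d - d'‖ ^ 2) := by
  refine (Real.le_sqrt_of_sq_le ?_).trans ((hL a b c d a b c' d').trans_eq (by simp))
  linarith [sq_nonneg ‖grad1f f a b c d - grad1f f a b c' d'‖,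
    sq_nonneg ‖grad3f f a b c d - grad3f f a b c' d'‖,
    sq_nonneg ‖grad4f f a b c d - grad4f f a b c' d'‖]

theorem descent_second_fourth {f : E4 n → E4 n → E3 n → E3 n → ℝ}
    (hf : ContDiff ℝ 1 fun p : (E4 n × E4 n) × E3 n × E3 n => f p.1.1 p.1.2 p.2.1 p.2.2)
    {L : ℝ}
    (hL : ∀ (a b : E4 n) (c d : E3 n) (b' : E4 n) (d' : E3 n),
      √(‖grad2f f a b c d - grad2f f a b' c d'‖ ^ 2
        + ‖grad4f f a b c d - grad4f f a b' c d'‖ ^ 2) ≤ L * √(‖b - b'‖ ^ 2 + ‖d - d'‖ ^ 2))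
    (a b b' : E4 n) (c d d' : E3 n) :
    f a b' c d' ≤ f a b c d + (⟪grad2f f a b c d, b' - b⟫ + ⟪grad4f f a b c d, d' - d⟫)
      + L / 2 * (‖b' - b‖ ^ 2 + ‖d' - d‖ ^ 2) := by
  set u := b' - b with hu
  set w := d' - d with hw
  have h := le_add_half_of_deriv_sub_le (C := L * (‖u‖ ^ 2 + ‖w‖ ^ 2))
    (hasDerivAt_second_fourth hf a b u c d w) ?_
  · have e1 : b + u = b' := by rw [hu]; abel
    have e2 : d + w = d' := by rw [hw]; abel
    simp only [one_smul, zero_smul, add_zero, e1, e2] at h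
    linarith
  intro t ht
  simp only [zero_smul, add_zero]
  have h1 := inner_add_inner_le_sqrt_mul_sqrt
    (grad2f f a (b + t • u) c (d + t • w) - grad2f f a b c d) u
    (grad4f f a (b + t • u) c (d + t • w) - grad4f f a b c d) w
  have h2 := mul_le_mul_of_nonneg_right (hL a (b + t • u) c (d + t • w) b d)
    (Real.sqrt_nonneg (‖u‖ ^ 2 + ‖w‖ ^ 2))
  have e : √(‖b + t • u - b‖ ^ 2 + ‖d + t • w - d‖ ^ 2) = t * √(‖u‖ ^ 2 + ‖w‖ ^ 2) := by
    rw [add_sub_cancel_left, add_sub_cancel_left, norm_smul, norm_smul, mul_pow, mul_pow,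
      ← mul_add, Real.sqrt_mul (by positivity), Real.sqrt_sq (norm_nonneg _),
      Real.norm_of_nonneg ht]
  have e2 : L * (t * √(‖u‖ ^ 2 + ‖w‖ ^ 2)) * √(‖u‖ ^ 2 + ‖w‖ ^ 2)
      = L * (‖u‖ ^ 2 + ‖w‖ ^ 2) * t := by
    linear_combination (L * t) * Real.mul_self_sqrt (show 0 ≤ ‖u‖ ^ 2 + ‖w‖ ^ 2 by positivity)
  rw [e, e2] at h2
  simp only [inner_sub_left] at h1
  linarith

theorem descent_g_second {g : E4 n → E4 n → ℝ}
    (hg : ContDiff ℝ 1 fun p : E4 n × E4 n => g p.1 p.2) {L : ℝ}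
    (hL : ∀ a b b' : E4 n, ‖grad2g g a b - grad2g g a b'‖ ≤ L * ‖b - b'‖) (a b b' : E4 n) :
    g a b' ≤ g a b + ⟪grad2g g a b, b' - b⟫ + L / 2 * ‖b' - b‖ ^ 2 := by
  set u := b' - b with hu
  have h := le_add_half_of_deriv_sub_le (C := L * ‖u‖ ^ 2)
    (fun t => (hasGradientAt_g_second hg a (b + t • u)).hasDerivAt_line) ?_
  · have e1 : b + u = b' := by rw [hu]; abel
    simp only [one_smul, zero_smul, add_zero, e1] at h
    linarith
  intro t ht
  simp only [zero_smul, add_zero]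
  have h1 := real_inner_le_norm (grad2g g a (b + t • u) - grad2g g a b) u
  have h2 := mul_le_mul_of_nonneg_right (hL a (b + t • u) b) (norm_nonneg u)
  rw [add_sub_cancel_left, norm_smul, Real.norm_of_nonneg ht] at h2
  rw [inner_sub_left] at h1
  linarith

end Smoothness

theorem dual_weight_nonneg {τ : ℝ} (hτ : τ ∈ Set.Ioo (0 : ℝ) 2) :
    0 ≤ τ - 1 + |1 - τ| / (1 - |1 - τ|) * τ := by
  obtain ⟨h0, h2⟩ := hτ
  rcases le_total τ 1 with h | h
  · rw [abs_of_nonneg (by linarith)]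
    have : (1 - τ) / (1 - (1 - τ)) * τ = 1 - τ := by
      rw [sub_sub_cancel, div_mul_cancel₀ _ h0.ne']
    linarith
  · rw [abs_of_nonpos (by linarith)]
    have : 0 ≤ -(1 - τ) / (1 - -(1 - τ)) :=
      div_nonneg (by linarith) (by linarith)
    nlinarith

/-- Lemma 5.4 (lower bound of the Lyapunov function): if `β > β′` then
`Ψ^{k+1} ≥ f* + g*` for all `k`. -/
theorem stmt16 (n : ℕ)
    (f : E4 n → E4 n → E3 n → E3 n → ℝ) (g : E4 n → E4 n → ℝ)
    (hf : ContDiff ℝ 1 fun p : (E4 n × E4 n) × E3 n × E3 n => f p.1.1 p.1.2 p.2.1 p.2.2)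
    (hg : ContDiff ℝ 1 fun p : E4 n × E4 n => g p.1 p.2)
    (Lf Lg : ℝ) (hLf : 0 < Lf) (hLg : 0 < Lg)
    (hfLip : ∀ a b : E4 n, ∀ c d : E3 n, ∀ a' b' : E4 n, ∀ c' d' : E3 n,
        Real.sqrt (‖grad1f f a b c d - grad1f f a' b' c' d'‖ ^ 2 +
            ‖grad2f f a b c d - grad2f f a' b' c' d'‖ ^ 2 +
            ‖grad3f f a b c d - grad3f f a' b' c' d'‖ ^ 2 +
            ‖grad4f f a b c d - grad4f f a' b' c' d'‖ ^ 2) ≤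
          Lf * Real.sqrt (‖a - a'‖ ^ 2 + ‖b - b'‖ ^ 2 + ‖c - c'‖ ^ 2 + ‖d - d'‖ ^ 2))
    (hgLip : ∀ a b a' b' : E4 n,
        Real.sqrt (‖grad1g g a b - grad1g g a' b'‖ ^ 2 +
            ‖grad2g g a b - grad2g g a' b'‖ ^ 2) ≤
          Lg * Real.sqrt (‖a - a'‖ ^ 2 + ‖b - b'‖ ^ 2))
    (hfconv1 : ∀ (b : E4 n) (c d : E3 n), ConvexOn ℝ Set.univ fun y => f y b c d)
    (hfconv2 : ∀ (a : E4 n) (c d : E3 n), ConvexOn ℝ Set.univ fun y => f a y c d)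
    (hfconv3 : ∀ (a b : E4 n) (d : E3 n), ConvexOn ℝ Set.univ fun y => f a b y d)
    (hfconv4 : ∀ (a b : E4 n) (c : E3 n), ConvexOn ℝ Set.univ fun y => f a b c y)
    (hgconv1 : ∀ b : E4 n, ConvexOn ℝ Set.univ fun y => g y b)
    (hgconv2 : ∀ a : E4 n, ConvexOn ℝ Set.univ fun y => g a y)
    (β τ : ℝ) (hβ : 0 < β) (hτ : τ ∈ Set.Ioo (0 : ℝ) 2)
    (H1 H2 : Matrix (Fin n × Fin 4) (Fin n × Fin 4) ℝ)
    (H3 H4 : Matrix (Fin n × Fin 3) (Fin n × Fin 3) ℝ)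
    (hH1 : H1.PosDef) (hH2 : H2.PosDef) (hH3 : H3.PosDef) (hH4 : H4.PosDef)
    (x1 x2 : ℕ → E4 n) (x3 x4 : ℕ → E3 n)
    (l1 : ℕ → E4 n) (l2 : ℕ → E3 n)
    (hbdd : ∃ R : ℝ, ∀ k, ‖x1 k‖ ≤ R ∧ ‖x2 k‖ ≤ R ∧ ‖x3 k‖ ≤ R ∧ ‖x4 k‖ ≤ R ∧
        ‖l1 k‖ ≤ R ∧ ‖l2 k‖ ≤ R)
    (hx1M : ∀ k, x1 k ∈ Msph n)
    (hmin1 : ∀ k, ∀ y ∈ Msph n,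
        augL f g β (x1 (k + 1)) (x2 k) (x3 k) (x4 k) (l1 k) (l2 k) +
            1 / 2 * qf H1 (x1 (k + 1) - x1 k) ≤
          augL f g β y (x2 k) (x3 k) (x4 k) (l1 k) (l2 k) + 1 / 2 * qf H1 (y - x1 k))
    (hmin2 : ∀ k, ∀ y : E4 n,
        augL f g β (x1 (k + 1)) (x2 (k + 1)) (x3 k) (x4 k) (l1 k) (l2 k) +
            1 / 2 * qf H2 (x2 (k + 1) - x2 k) ≤
          augL f g β (x1 (k + 1)) y (x3 k) (x4 k) (l1 k) (l2 k) + 1 / 2 * qf H2 (y - x2 k))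
    (hmin3 : ∀ k, ∀ y : E3 n,
        augL f g β (x1 (k + 1)) (x2 (k + 1)) (x3 (k + 1)) (x4 k) (l1 k) (l2 k) +
            1 / 2 * qf H3 (x3 (k + 1) - x3 k) ≤
          augL f g β (x1 (k + 1)) (x2 (k + 1)) y (x4 k) (l1 k) (l2 k) +
            1 / 2 * qf H3 (y - x3 k))
    (hmin4 : ∀ k, ∀ y : E3 n,
        augL f g β (x1 (k + 1)) (x2 (k + 1)) (x3 (k + 1)) (x4 (k + 1)) (l1 k) (l2 k) +
            1 / 2 * qf H4 (x4 (k + 1) - x4 k) ≤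
          augL f g β (x1 (k + 1)) (x2 (k + 1)) (x3 (k + 1)) y (l1 k) (l2 k) +
            1 / 2 * qf H4 (y - x4 k))
    (hdual1 : ∀ k, l1 (k + 1) = l1 k - (τ * β) • (x1 (k + 1) - x2 (k + 1)))
    (hdual2 : ∀ k, l2 (k + 1) = l2 k - (τ * β) • (x3 (k + 1) - x4 (k + 1)))
    (α1 α2 : ℝ)
    (hα1 : α1 = |1 - τ| / (1 - |1 - τ|))
    (hα2 : α2 = τ / (1 - |1 - τ|) ^ 2)
    (Lg2 : ℝ) (hLg2 : 0 < Lg2)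
    (hg2Lip : ∀ a b b' : E4 n, ‖grad2g g a b - grad2g g a b'‖ ≤ Lg2 * ‖b - b'‖)
    (fstar gstar : ℝ)
    (hfstar : IsGLB {r : ℝ | ∃ y1 ∈ Msph n, ∃ (y2 : E4 n) (y3 y4 : E3 n),
        r = f y1 y2 y3 y4} fstar)
    (hgstar : IsGLB {r : ℝ | ∃ y1 ∈ Msph n, ∃ y2 : E4 n, r = g y1 y2} gstar)
    (k1lo k2lo k2hi k3lo k4lo k4hi : ℝ)
    (hk1lo : IsLeast {μ : ℝ | ∃ v : (Fin n × Fin 4) → ℝ, v ≠ 0 ∧ H1 *ᵥ v = μ • v} k1lo)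
    (hk2lo : IsLeast {μ : ℝ | ∃ v : (Fin n × Fin 4) → ℝ, v ≠ 0 ∧ H2 *ᵥ v = μ • v} k2lo)
    (hk2hi : IsGreatest {μ : ℝ | ∃ v : (Fin n × Fin 4) → ℝ, v ≠ 0 ∧ H2 *ᵥ v = μ • v} k2hi)
    (hk3lo : IsLeast {μ : ℝ | ∃ v : (Fin n × Fin 3) → ℝ, v ≠ 0 ∧ H3 *ᵥ v = μ • v} k3lo)
    (hk4lo : IsLeast {μ : ℝ | ∃ v : (Fin n × Fin 3) → ℝ, v ≠ 0 ∧ H4 *ᵥ v = μ • v} k4lo)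
    (hk4hi : IsGreatest {μ : ℝ | ∃ v : (Fin n × Fin 3) → ℝ, v ≠ 0 ∧ H4 *ᵥ v = μ • v} k4hi)
    (βone : ℝ)
    (hβone : βone = max (2 * (Lf + Lg2)) (max (2 * α2 / k1lo * (7 * Lf ^ 2 + 4 * Lg ^ 2))
        (max (α2 / k2lo * (7 * Lf ^ 2 + 4 * Lg ^ 2) + (4 * α2 + 2) * k2hi ^ 2 / k2lo)
          (max ((3 * α2 + 2) / k3lo * Lf ^ 2)
            ((3 * α2 + 2) / k4lo * Lf ^ 2 + (3 * α2 + 1) * k4hi ^ 2 / k4lo)))))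
    (hβgt : β > βone)
    (M1 M2 : Matrix (Fin n × Fin 4) (Fin n × Fin 4) ℝ)
    (M3 M4 : Matrix (Fin n × Fin 3) (Fin n × Fin 3) ℝ)
    (hM1 : M1 = (1 / 2 : ℝ) • H1 - (α2 / β * (7 * Lf ^ 2 + 4 * Lg ^ 2)) • 1)
    (hM2 : M2 = H2 - (α2 / β) • ((7 * Lf ^ 2 + 4 * Lg ^ 2) • 1 + (4 : ℝ) • (H2ᵀ * H2)))
    (hM3 : M3 = H3 - (3 * α2 / β * Lf ^ 2) • 1)
    (hM4 : M4 = H4 - (α2 / β) • ((3 * Lf ^ 2) • 1 + (3 : ℝ) • (H4ᵀ * H4)))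
    :
    ∀ k : ℕ,
      fstar + gstar ≤
        augL f g β (x1 (k + 1)) (x2 (k + 1)) (x3 (k + 1)) (x4 (k + 1))
            (l1 (k + 1)) (l2 (k + 1)) +
          α1 / (τ * β) * (‖l1 (k + 1) - l1 k‖ ^ 2 + ‖l2 (k + 1) - l2 k‖ ^ 2) +
          (qf M1 (x1 (k + 1) - x1 k) + qf M2 (x2 (k + 1) - x2 k) +
            qf M3 (x3 (k + 1) - x3 k) + qf M4 (x4 (k + 1) - x4 k)) := by
  intro k
  have hτ0 : 0 < τ := hτ.1
  have hk1 := pos_of_isLeast hH1 hk1lo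
  have hk2 := pos_of_isLeast hH2 hk2lo
  have hk3 := pos_of_isLeast hH3 hk3lo
  have hk4 := pos_of_isLeast hH4 hk4lo
  rw [hβone, gt_iff_lt, max_lt_iff, max_lt_iff, max_lt_iff, max_lt_iff] at hβgt
  obtain ⟨hb0, hb1, hb2, hb3, hb4⟩ := hβgt
  have hα2pos : 0 ≤ α2 := by rw [hα2]; positivity
  set r := x1 (k + 1) - x2 (k + 1) with hr
  set s := x3 (k + 1) - x4 (k + 1) with hs
  set d1 := x1 (k + 1) - x1 k with hd1
  set d2 := x2 (k + 1) - x2 k with hd2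
  set d3 := x3 (k + 1) - x3 k with hd3
  set d4 := x4 (k + 1) - x4 k with hd4
  -- the four quadratic terms
  have q1 : 0 ≤ qf M1 d1 := by
    have h := le_qf_of_isLeast hH1.1 hk1lo d1
    rw [hM1, qf_sub, qf_smul, qf_smul, qf_one]
    have hc : α2 / β * (7 * Lf ^ 2 + 4 * Lg ^ 2) ≤ k1lo / 2 := by
      rw [div_mul_eq_mul_div, div_lt_iff₀ hk1] at hb1
      rw [div_mul_eq_mul_div, div_le_iff₀ hβ]
      linarith
    nlinarith [mul_le_mul_of_nonneg_right hc (sq_nonneg ‖d1‖)]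
  have q2 : 2 / β * ‖Matrix.toEuclideanLin H2 d2‖ ^ 2 ≤ qf M2 d2 := by
    rw [div_mul_eq_mul_div, ← add_div, div_lt_iff₀ hk2] at hb2
    have h := qf_shifted_lower_bound hH2 (α := α2) (c := 7 * Lf ^ 2 + 4 * Lg ^ 2) (e := 0)
      (p := 4) (q := 2) hβ hk2lo hk2hi (by positivity) (by linarith) d2
    rw [hM2]
    refine le_trans (le_of_eq ?_) h
    ring
  have q3 : 2 / β * (Lf ^ 2 * ‖d3‖ ^ 2) ≤ qf M3 d3 := by
    have h := le_qf_of_isLeast hH3.1 hk3lo d3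
    rw [hM3, qf_sub, qf_smul, qf_one]
    rw [div_mul_eq_mul_div, div_lt_iff₀ hk3] at hb3
    refine le_of_mul_le_mul_left ?_ hβ
    have e : β * (qf H3 d3 - 3 * α2 / β * Lf ^ 2 * ‖d3‖ ^ 2) = β * qf H3 d3
        - 3 * α2 * Lf ^ 2 * ‖d3‖ ^ 2 := by field_simp
    have e' : β * (2 / β * (Lf ^ 2 * ‖d3‖ ^ 2)) = 2 * (Lf ^ 2 * ‖d3‖ ^ 2) := by field_simp
    rw [e, e']
    linarith [mul_le_mul_of_nonneg_left h hβ.le,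
      mul_le_mul_of_nonneg_right hb3.le (sq_nonneg ‖d3‖)]
  have q4 : 2 / β * (Lf ^ 2 * ‖d4‖ ^ 2) + 1 / β * ‖Matrix.toEuclideanLin H4 d4‖ ^ 2
      ≤ qf M4 d4 := by
    rw [div_mul_eq_mul_div, ← add_div, div_lt_iff₀ hk4] at hb4
    have h := qf_shifted_lower_bound hH4 (α := α2) (c := 3 * Lf ^ 2) (e := 2 * Lf ^ 2)
      (p := 3) (q := 1) hβ hk4lo hk4hi (by positivity) (by linarith) d4
    rw [hM4]
    refine le_trans (le_of_eq ?_) h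
    ring
  -- first-order conditions for the second and fourth blocks
  have o2 := inner_residual_of_prox_min hH2.1 (a := x1 (k + 1)) (b := x2 k) (l := l1 k) (β := β)
    (F := fun y => f (x1 (k + 1)) y (x3 k) (x4 k) + g (x1 (k + 1)) y)
    (y := x2 (k + 1))
    (G := grad2f f (x1 (k + 1)) (x2 (k + 1)) (x3 k) (x4 k)
      + grad2g g (x1 (k + 1)) (x2 (k + 1)))
    ((hasGradientAt_second hf _ _ _ _).add_fun (hasGradientAt_g_second hg _ _)) (by
      intro z
      have h := hmin2 k z
      simp only [augL] at h
      linarith)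
  have o4 := inner_residual_of_prox_min hH4.1 (a := x3 (k + 1)) (b := x4 k) (l := l2 k) (β := β)
    (F := fun y => f (x1 (k + 1)) (x2 (k + 1)) (x3 (k + 1)) y)
    (y := x4 (k + 1)) (hasGradientAt_fourth hf _ _ _ _) (by
      intro z
      have h := hmin4 k z
      simp only [augL] at h
      linarith)
  rw [← hr, ← hd2, inner_add_left] at o2
  rw [← hs, ← hd4] at o4
  -- descent to the feasible point
  have df := descent_second_fourth hf (L := Lf)
    (fun a b c d b' d' => lipschitz_second_fourth hfLip a b c d b' d')
    (x1 (k + 1)) (x2 (k + 1)) (x1 (k + 1)) (x3 (k + 1)) (x4 (k + 1)) (x3 (k + 1))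
  have dg := descent_g_second hg hg2Lip (x1 (k + 1)) (x2 (k + 1)) (x1 (k + 1))
  rw [← hr, ← hs] at df
  rw [← hr] at dg
  have lf : fstar ≤ f (x1 (k + 1)) (x1 (k + 1)) (x3 (k + 1)) (x3 (k + 1)) :=
    hfstar.1 ⟨_, hx1M (k + 1), _, _, _, rfl⟩
  have lg : gstar ≤ g (x1 (k + 1)) (x1 (k + 1)) :=
    hgstar.1 ⟨_, hx1M (k + 1), _, rfl⟩
  -- error terms
  set G := grad2f f (x1 (k + 1)) (x2 (k + 1)) (x3 (k + 1)) (x4 (k + 1)) with hG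
  set G' := grad2f f (x1 (k + 1)) (x2 (k + 1)) (x3 k) (x4 k) with hG'
  have hGG : ‖G' - G‖ ^ 2 ≤ Lf ^ 2 * (‖d3‖ ^ 2 + ‖d4‖ ^ 2) := by
    have h1 := lipschitz_second hfLip (x1 (k + 1)) (x2 (k + 1)) (x3 k) (x4 k)
      (x3 (k + 1)) (x4 (k + 1))
    rw [← hG, ← hG', norm_sub_rev (x3 k), norm_sub_rev (x4 k), ← hd3, ← hd4] at h1
    have h2 := pow_le_pow_left₀ (norm_nonneg _) h1 2
    rwa [mul_pow, Real.sq_sqrt (by positivity)] at h2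
  have y1 := neg_inner_le_young (half_pos hβ) (G' - G) r
  have y2 := neg_inner_le_young (half_pos hβ) (Matrix.toEuclideanLin H2 d2) r
  have y4 := neg_inner_le_young hβ (Matrix.toEuclideanLin H4 d4) s
  have e2 : 1 / (β / 2) = 2 / β := by field_simp
  rw [e2] at y1 y2
  rw [inner_sub_left] at y1
  have hGG' := mul_le_mul_of_nonneg_left hGG (show 0 ≤ 2 / β by positivity)
  -- dual terms
  have hw := mul_nonneg (mul_nonneg hβ.le (dual_weight_nonneg hτ))
    (show 0 ≤ ‖r‖ ^ 2 + ‖s‖ ^ 2 by positivity)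
  rw [← hα1] at hw
  have n1 : l1 (k + 1) - l1 k = -((τ * β) • r) := by rw [hdual1 k, ← hr]; abel
  have n2 : l2 (k + 1) - l2 k = -((τ * β) • s) := by rw [hdual2 k, ← hs]; abel
  have n3 : α1 / (τ * β) * (‖l1 (k + 1) - l1 k‖ ^ 2 + ‖l2 (k + 1) - l2 k‖ ^ 2)
      = α1 * τ * β * (‖r‖ ^ 2 + ‖s‖ ^ 2) := by
    rw [n1, n2, norm_neg, norm_neg, norm_smul, norm_smul, mul_pow, mul_pow, Real.norm_eq_abs,
      sq_abs]
    field_simp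
  have n4 : ⟪l1 (k + 1), r⟫ = ⟪l1 k, r⟫ - τ * β * ‖r‖ ^ 2 := by
    rw [hdual1 k, ← hr, inner_sub_left, real_inner_smul_left, real_inner_self_eq_norm_sq]
  have n5 : ⟪l2 (k + 1), s⟫ = ⟪l2 k, s⟫ - τ * β * ‖s‖ ^ 2 := by
    rw [hdual2 k, ← hs, inner_sub_left, real_inner_smul_left, real_inner_self_eq_norm_sq]
  rw [n3, augL, ← hr, ← hs, n4, n5]
  have z1 := mul_nonneg (show 0 ≤ β / 4 - Lf / 2 - Lg2 / 2 by linarith) (sq_nonneg ‖r‖)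
  have z2 := mul_nonneg (show 0 ≤ β / 4 - Lf / 2 by linarith) (sq_nonneg ‖s‖)
  linarith

end
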